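/- ∫₀¹ K(2√(x(1-x))) (4x + 3√2 − 2) / (4√2 + 9 − 8√2 x)^{3/2} dx = π/(4√2). -/

import Mathlib

open MeasureTheory Real Filter

/-- Pochhammer symbol `(x)_n`. -/
noncomputable def poch (x : ℝ) (n : ℕ) : ℝ := ∏ i ∈ Finset.range n, (x + i)

/-- Complete elliptic integral of the first kind. -/
noncomputable def K (k : ℝ) : ℝ :=
  ∫ θ in Set.Ioo 0 (Real.pi / 2), 1 / Real.sqrt (1 - k ^ 2 * Real.sin θ ^ 2)

/-- `K` as a function of the squared modulus, via the hypergeometric series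
`K(k) = (π/2) ₂F₁(1/2,1/2;1;k²)`. -/
noncomputable def Ksq (m : ℝ) : ℝ :=
  (Real.pi / 2) * ∑' n : ℕ, poch (1/2) n ^ 2 / poch 1 n ^ 2 * m ^ n

/-- Legendre polynomial `P_n(x)`. -/
noncomputable def P (n : ℕ) (x : ℝ) : ℝ :=
  (1 / 2 ^ n) * ∑ k ∈ Finset.range (n + 1), (n.choose k : ℝ) ^ 2 * (x - 1) ^ (n - k) * (x + 1) ^ k

lemma poch_zero (x : ℝ) : poch x 0 = 1 := by simp [poch]

lemma poch_succ (x : ℝ) (n : ℕ) : poch x (n + 1) = poch x n * (x + n) := by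
  simp [poch, Finset.prod_range_succ]

lemma mul_poch_add_one (x : ℝ) (n : ℕ) : x * poch (x + 1) n = poch x n * (x + n) := by
  induction n with
  | zero => simp [poch_zero]
  | succ n ih =>
    rw [poch_succ, poch_succ, ← mul_assoc, ih]
    push_cast
    ring

lemma poch_pos {x : ℝ} (hx : 0 < x) (n : ℕ) : 0 < poch x n :=
  Finset.prod_pos fun i _ => by positivity

/-- The hypergeometric term of the Wilf–Zeilberger family, without its linear factor. -/
noncomputable def wzTerm (k : ℝ) (n : ℕ) : ℝ :=
  poch (1 / 2) n ^ 2 * poch (1 / 2 + 2 * k) n / (n.factorial * poch (1 + k) n ^ 2) * (-1 / 8) ^ n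

lemma wzTerm_zero (k : ℝ) : wzTerm k 0 = 1 := by simp [wzTerm, poch_zero]

lemma wzTerm_succ {k : ℝ} (hk : 0 ≤ k) (n : ℕ) :
    wzTerm k (n + 1) = wzTerm k n *
      (-((n + 1 / 2) ^ 2 * (n + 1 / 2 + 2 * k) / (8 * (n + 1) * (n + 1 + k) ^ 2))) := by
  have h1 : poch (1 + k) n ≠ 0 := (poch_pos (by positivity) n).ne'
  have h2 : (1 + k + n : ℝ) ≠ 0 := by positivity
  have h3 : (n + 1 + k : ℝ) ≠ 0 := by positivity
  have h4 : (n.factorial : ℝ) ≠ 0 := by positivity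
  have h5 : (n + 1 : ℝ) ≠ 0 := by positivity
  simp only [wzTerm, poch_succ, Nat.factorial_succ, pow_succ]
  push_cast
  rw [show (1 + k + n : ℝ) = n + 1 + k by ring]
  field_simp
  ring

lemma wzTerm_add_one {k : ℝ} (hk : 0 ≤ k) (n : ℕ) :
    (k + 1 / 4) * (k + 3 / 4) * wzTerm (k + 1) n =
      (k + 1) ^ 2 * wzTerm k n *
        ((n + 1 / 2 + 2 * k) * (n + 3 / 2 + 2 * k) / (4 * (n + 1 + k) ^ 2)) := by
  have h1 : poch (1 + k) n ≠ 0 := (poch_pos (by positivity) n).ne'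
  have h1' : poch (1 + k + 1) n ≠ 0 := (poch_pos (by positivity) n).ne'
  have h3 : (n + 1 + k : ℝ) ≠ 0 := by positivity
  have h4 : (n.factorial : ℝ) ≠ 0 := by positivity
  have e1 := mul_poch_add_one (1 + k) n
  have e2 := mul_poch_add_one (1 / 2 + 2 * k) n
  have e3 := mul_poch_add_one (1 / 2 + 2 * k + 1) n
  have e4 : (1 / 2 + 2 * k) * (3 / 2 + 2 * k) * poch (1 / 2 + 2 * (k + 1)) n =
      poch (1 / 2 + 2 * k) n * (n + 1 / 2 + 2 * k) * (n + 3 / 2 + 2 * k) := by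
    rw [show 1 / 2 + 2 * (k + 1) = 1 / 2 + 2 * k + 1 + 1 by ring]
    linear_combination (1 / 2 + 2 * k) * e3 + (n + 3 / 2 + 2 * k) * e2
  have e5 : poch (1 + k + 1) n = poch (1 + k) n * (n + 1 + k) / (1 + k) := by
    field_simp
    linear_combination e1
  have h6 : 1 + k ≠ 0 := by positivity
  rw [wzTerm, wzTerm, show (1 + (k + 1) : ℝ) = 1 + k + 1 by ring, e5]
  generalize poch (1 / 2 + 2 * (k + 1)) n = A at e4 ⊢
  generalize poch (1 / 2 + 2 * k) n = B at e4 ⊢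
  field_simp
  linear_combination 16 * (k + 1) ^ 2 * poch (1 / 2) n ^ 2 * e4

lemma wz_telescope {k : ℝ} (hk : 0 ≤ k) (n : ℕ) :
    (k + 1 / 4) * (k + 3 / 4) * (wzTerm (k + 1) n * (6 * n + 4 * (k + 1) + 1)) -
        (k + 1) ^ 2 * (wzTerm k n * (6 * n + 4 * k + 1)) =
      4 * (n + 1 : ℕ) * (k + 1) ^ 2 * wzTerm k (n + 1) - 4 * n * (k + 1) ^ 2 * wzTerm k n := by
  have h3 : (n + 1 + k : ℝ) ≠ 0 := by positivity
  have h5 : (n + 1 : ℝ) ≠ 0 := by positivity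
  rw [← mul_assoc, wzTerm_add_one hk, wzTerm_succ hk]
  push_cast
  field_simp
  ring

lemma abs_wzTerm_succ_le {k : ℝ} (hk : 0 ≤ k) (n : ℕ) :
    |wzTerm k (n + 1)| ≤ |wzTerm k n| * (1 / 4) := by
  rw [wzTerm_succ hk, abs_mul]
  refine mul_le_mul_of_nonneg_left ?_ (abs_nonneg _)
  rw [abs_neg, abs_of_nonneg (by positivity), div_le_iff₀ (by positivity)]
  have hn : (0 : ℝ) ≤ n := n.cast_nonneg
  have h1 : ((n : ℝ) + 1 / 2) ^ 2 ≤ (n + 1) * (n + 1 + k) := by nlinarith [mul_nonneg hn hk]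
  have h2 : (n : ℝ) + 1 / 2 + 2 * k ≤ 2 * (n + 1 + k) := by linarith
  calc _ ≤ (n + 1) * (n + 1 + k) * (2 * (n + 1 + k)) := by gcongr
    _ = _ := by ring

lemma abs_wzTerm_le {k : ℝ} (hk : 0 ≤ k) (n : ℕ) : |wzTerm k n| ≤ (1 / 4) ^ n := by
  induction n with
  | zero => simp [wzTerm_zero]
  | succ n ih =>
    rw [pow_succ]
    exact (abs_wzTerm_succ_le hk n).trans (by gcongr)

lemma abs_wzTerm_succ_le_div {k : ℝ} (hk : 0 ≤ k) (n : ℕ) :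
    |wzTerm k (n + 1)| ≤ (1 / 4) ^ n / (k + 1) := by
  induction n with
  | zero =>
    rw [wzTerm_succ hk, wzTerm_zero]
    rw [one_mul, abs_neg, abs_of_nonneg (by positivity), div_le_div_iff₀ (by positivity)
      (by positivity)]
    norm_num
    nlinarith
  | succ n ih =>
    rw [pow_succ, mul_div_right_comm]
    exact (abs_wzTerm_succ_le hk (n + 1)).trans (by gcongr)

lemma summable_geometric_linear (a b : ℝ) :
    Summable fun n : ℕ => (1 / 4 : ℝ) ^ n * (a * n + b) := by
  have h1 : Summable fun n : ℕ => (n : ℝ) ^ 1 * (1 / 4 : ℝ) ^ n :=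
    summable_pow_mul_geometric_of_norm_lt_one 1 (by norm_num)
  have h2 : Summable fun n : ℕ => (1 / 4 : ℝ) ^ n :=
    summable_geometric_of_lt_one (by norm_num) (by norm_num)
  refine ((h1.mul_left a).add (h2.mul_left b)).congr fun n => ?_
  ring

lemma summable_wz {k : ℝ} (hk : 0 ≤ k) :
    Summable fun n : ℕ => wzTerm k n * (6 * n + 4 * k + 1) := by
  refine Summable.of_norm_bounded (summable_geometric_linear 6 (4 * k + 1)) fun n => ?_
  rw [norm_mul, Real.norm_eq_abs, Real.norm_eq_abs, abs_of_nonneg (a := 6 * (n : ℝ) + 4 * k + 1)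
    (by positivity), add_assoc]
  gcongr
  exact abs_wzTerm_le hk n

/-- The sum of the Wilf–Zeilberger family. -/
noncomputable def wzSum (k : ℝ) : ℝ := ∑' n : ℕ, wzTerm k n * (6 * n + 4 * k + 1)

lemma wzSum_add_one {k : ℝ} (hk : 0 ≤ k) :
    (k + 1 / 4) * (k + 3 / 4) * wzSum (k + 1) = (k + 1) ^ 2 * wzSum k := by
  have h1 := ((summable_wz (k := k + 1) (by positivity)).hasSum.mul_left
    ((k + 1 / 4) * (k + 3 / 4))).sub ((summable_wz hk).hasSum.mul_left ((k + 1) ^ 2))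
  simp_rw [wz_telescope hk] at h1
  have h2 := h1.tendsto_sum_nat
  simp_rw [Finset.sum_range_sub (fun n : ℕ => 4 * (n : ℝ) * (k + 1) ^ 2 * wzTerm k n)] at h2
  have h3 : Tendsto (fun n : ℕ => 4 * (n : ℝ) * (k + 1) ^ 2 * wzTerm k n
      - 4 * ((0 : ℕ) : ℝ) * (k + 1) ^ 2 * wzTerm k 0) atTop (nhds 0) := by
    refine squeeze_zero_norm (a := fun n : ℕ => (1 / 4 : ℝ) ^ n * (4 * (k + 1) ^ 2 * n + 0)) ?_
      (summable_geometric_linear _ _).tendsto_atTop_zero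
    intro n
    simp only [Nat.cast_zero, mul_zero, zero_mul, sub_zero, add_zero]
    rw [norm_mul, Real.norm_eq_abs, Real.norm_eq_abs,
      abs_of_nonneg (a := 4 * (n : ℝ) * (k + 1) ^ 2) (by positivity)]
    calc _ ≤ 4 * (n : ℝ) * (k + 1) ^ 2 * (1 / 4) ^ n := by gcongr; exact abs_wzTerm_le hk n
      _ = _ := by ring
  have h4 := tendsto_nhds_unique h2 h3
  unfold wzSum
  linarith

lemma abs_wzSum_sub_le {k : ℝ} (hk : 0 ≤ k) :
    |wzSum k - (4 * k + 1)| ≤ ∑' n : ℕ, (1 / 4 : ℝ) ^ n * (6 * n + 10) := by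
  have h1 : wzSum k - (4 * k + 1) =
      ∑' n : ℕ, wzTerm k (n + 1) * (6 * (n + 1 : ℕ) + 4 * k + 1) := by
    unfold wzSum
    rw [(summable_wz hk).tsum_eq_zero_add, wzTerm_zero]
    push_cast
    ring
  rw [h1, ← Real.norm_eq_abs]
  refine tsum_of_norm_bounded (summable_geometric_linear 6 10).hasSum fun n => ?_
  rw [norm_mul, Real.norm_eq_abs, Real.norm_eq_abs,
    abs_of_nonneg (a := 6 * ((n + 1 : ℕ) : ℝ) + 4 * k + 1) (by positivity)]
  calc _ ≤ (1 / 4) ^ n / (k + 1) * (6 * ((n + 1 : ℕ) : ℝ) + 4 * k + 1) := by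
        gcongr; exact abs_wzTerm_succ_le_div hk n
    _ = (1 / 4) ^ n * ((6 * ((n + 1 : ℕ) : ℝ) + 4 * k + 1) / (k + 1)) := by ring
    _ ≤ _ := by
        gcongr
        rw [div_le_iff₀ (by positivity)]
        push_cast
        nlinarith [mul_nonneg (n.cast_nonneg : (0 : ℝ) ≤ n) hk]

lemma wzSum_zero_eq (N : ℕ) :
    wzSum 0 * (N.factorial : ℝ) ^ 2 = poch (1 / 4) N * poch (3 / 4) N * wzSum N := by
  induction N with
  | zero => simp [poch_zero]
  | succ N ih =>
    have h := wzSum_add_one (k := N) N.cast_nonneg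
    rw [Nat.factorial_succ, poch_succ, poch_succ]
    push_cast
    linear_combination ((N : ℝ) + 1) ^ 2 * ih - poch (1 / 4) N * poch (3 / 4) N * h

lemma wzSum_zero : wzSum 0 = 2 * √2 / π := by
  set C := ∑' n : ℕ, (1 / 4 : ℝ) ^ n * (6 * n + 10)
  have hinv : Tendsto (fun N : ℕ => (1 : ℝ) / (N + 1)) atTop (nhds 0) :=
    tendsto_one_div_add_atTop_nhds_zero_nat
  have hratio : Tendsto (fun N : ℕ => wzSum (N + 1 : ℕ) / (N + 1)) atTop (nhds 4) := by
    have h1 : Tendsto (fun N : ℕ => (wzSum (N + 1 : ℕ) - (4 * (N + 1 : ℕ) + 1)) * (1 / (N + 1)))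
        atTop (nhds 0) := by
      refine squeeze_zero_norm (a := fun N : ℕ => C * (1 / (N + 1))) (fun N => ?_) ?_
      · rw [norm_mul, Real.norm_eq_abs, Real.norm_eq_abs,
          abs_of_nonneg (a := 1 / ((N : ℝ) + 1)) (by positivity)]
        gcongr
        exact abs_wzSum_sub_le (Nat.cast_nonneg _)
      · simpa using hinv.const_mul C
    have h2 := (h1.add_const 4).add hinv
    simp only [zero_add, add_zero] at h2
    refine h2.congr fun N => ?_
    have : (N + 1 : ℝ) ≠ 0 := by positivity
    push_cast
    field_simp
    ring
  have hGamma := (Real.GammaSeq_tendsto_Gamma (1 / 4)).mul (Real.GammaSeq_tendsto_Gamma (3 / 4))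
  have hlim : Tendsto (fun N : ℕ => wzSum (N + 1 : ℕ) / (N + 1) * (1 - 1 / ((N : ℝ) + 1))) atTop
      (nhds (4 * (1 - 0))) := hratio.mul (hinv.const_sub 1)
  have heq : ∀ᶠ N : ℕ in atTop, wzSum (N + 1 : ℕ) / (N + 1) * (1 - 1 / ((N : ℝ) + 1)) =
      wzSum 0 * (Real.GammaSeq (1 / 4) N * Real.GammaSeq (3 / 4) N) := by
    filter_upwards [eventually_gt_atTop 0] with N hN
    have hN' : (0 : ℝ) < N := by exact_mod_cast hN
    have h := wzSum_zero_eq (N + 1)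
    have p1 := poch_pos (x := 1 / 4) (by norm_num) (N + 1)
    have p2 := poch_pos (x := 3 / 4) (by norm_num) (N + 1)
    have hpow : (N : ℝ) ^ (1 / 4 : ℝ) * (N : ℝ) ^ (3 / 4 : ℝ) = N := by
      rw [← Real.rpow_add hN']; norm_num
    have hG : Real.GammaSeq (1 / 4) N * Real.GammaSeq (3 / 4) N =
        N * (N.factorial : ℝ) ^ 2 / (poch (1 / 4) (N + 1) * poch (3 / 4) (N + 1)) := by
      rw [Real.GammaSeq, Real.GammaSeq, ← poch, ← poch, div_mul_div_comm]
      congr 1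
      linear_combination (N.factorial : ℝ) ^ 2 * hpow
    rw [hG]
    rw [Nat.factorial_succ] at h
    have : (N + 1 : ℝ) ≠ 0 := by positivity
    push_cast at h ⊢
    field_simp
    linear_combination -(N : ℝ) * h
  have hval := tendsto_nhds_unique (hlim.congr' heq) (hGamma.const_mul (wzSum 0))
  have hrefl := Real.Gamma_mul_Gamma_one_sub (1 / 4)
  rw [show (1 : ℝ) - 1 / 4 = 3 / 4 by norm_num, show π * (1 / 4) = π / 4 by ring,
    Real.sin_pi_div_four] at hrefl
  rw [hrefl] at hval
  have hs : √2 * √2 = 2 := Real.mul_self_sqrt (by norm_num)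
  have hs0 : √2 ≠ 0 := by positivity
  field_simp at hval ⊢
  nlinarith

/-- The summand of the terminating Saalschützian series `₃F₂(-(p+l), p+l+1/2, 1/2; 1, 1; 1)`. -/
noncomputable def saalTerm (p l : ℕ) : ℝ :=
  poch (1 / 2) (2 * p + l) * poch (1 / 2) p * (-1) ^ p / (p.factorial ^ 3 * l.factorial)

/-- The Wilf–Zeilberger certificate for `saalTerm`. -/
noncomputable def saalCert (m p : ℕ) : ℝ :=
  -(2 * m + 3 / 2) * p ^ 3 * (poch (1 / 2) (m + p) * poch (1 / 2) p * (-1) ^ p /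
    (p.factorial ^ 3 * (m + 1 - p).factorial))

lemma saal_telescope {m p : ℕ} (hp : p ≤ m) :
    (m + 1 : ℝ) ^ 3 * saalTerm p (m + 1 - p) - (m + 1 / 2) ^ 3 * saalTerm p (m - p) =
      saalCert m (p + 1) - saalCert m p := by
  obtain ⟨l, rfl⟩ := Nat.exists_eq_add_of_le hp
  have e1 : p + l + 1 - p = l + 1 := by omega
  have e2 : p + l - p = l := by omega
  have e3 : p + l + 1 - (p + 1) = l := by omega
  have e4 : p + l + p = 2 * p + l := by omega
  have e5 : p + l + (p + 1) = 2 * p + l + 1 := by omega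
  simp only [saalTerm, saalCert, e1, e2, e3, e4, e5, ← add_assoc, poch_succ, Nat.factorial_succ,
    pow_succ]
  have h1 : (p.factorial : ℝ) ≠ 0 := by positivity
  have h2 : (l.factorial : ℝ) ≠ 0 := by positivity
  have h3 : (p + 1 : ℝ) ≠ 0 := by positivity
  have h4 : (l + 1 : ℝ) ≠ 0 := by positivity
  push_cast
  field_simp
  ring

lemma sum_saalTerm (m : ℕ) :
    ∑ p ∈ Finset.range (m + 1), saalTerm p (m - p) = (poch (1 / 2) m / m.factorial) ^ 3 := by
  induction m with
  | zero => simp [saalTerm, poch_zero]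
  | succ m ih =>
    have h1 : ∑ p ∈ Finset.range (m + 1), ((m + 1 : ℝ) ^ 3 * saalTerm p (m + 1 - p) -
        (m + 1 / 2) ^ 3 * saalTerm p (m - p)) = saalCert m (m + 1) - saalCert m 0 := by
      rw [← Finset.sum_range_sub]
      refine Finset.sum_congr rfl fun p hp => saal_telescope ?_
      have := Finset.mem_range.mp hp
      omega
    rw [Finset.sum_sub_distrib, ← Finset.mul_sum, ← Finset.mul_sum, ih] at h1
    have h2 : saalCert m (m + 1) = -(m + 1 : ℝ) ^ 3 * saalTerm (m + 1) 0 := by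
      have e : m + (m + 1) = 2 * m + 1 := by omega
      have e' : 2 * (m + 1) + 0 = 2 * m + 1 + 1 := by omega
      rw [saalCert, saalTerm, e, e', poch_succ _ (2 * m + 1)]
      simp only [Nat.sub_self]
      push_cast
      ring
    have h3 : saalCert m 0 = 0 := by simp [saalCert]
    have h4 : (m + 1 : ℝ) ≠ 0 := by positivity
    have h5 : (m.factorial : ℝ) ≠ 0 := by positivity
    rw [Finset.sum_range_succ, Nat.sub_self]
    rw [h2, h3] at h1
    have h6 : (m + 1 : ℝ) ^ 3 * (∑ p ∈ Finset.range (m + 1), saalTerm p (m + 1 - p) +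
        saalTerm (m + 1) 0) = (m + 1 / 2) ^ 3 * (poch (1 / 2) m / m.factorial) ^ 3 := by
      linear_combination h1
    rw [poch_succ, Nat.factorial_succ]
    have h7 : ((m : ℝ) + 1) ^ 3 ≠ 0 := by positivity
    refine mul_left_cancel₀ h7 (h6.trans ?_)
    push_cast
    field_simp
    ring

lemma poch_eq_factorial_mul_choose (a : ℝ) (n : ℕ) :
    poch a n = n.factorial * Ring.choose (a + n - 1) n := by
  rw [← Ring.multichoose_eq, ← nsmul_eq_mul, Ring.factorial_nsmul_multichoose_eq_ascPochhammer,
    Polynomial.ascPochhammer_smeval_eq_eval]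
  induction n with
  | zero => simp [poch_zero]
  | succ n ih => rw [poch_succ, ih, ascPochhammer_succ_eval]

lemma hasSum_poch_div_factorial (a : ℝ) {q : ℝ} (hq : |q| < 1) :
    HasSum (fun n : ℕ => poch a n / n.factorial * q ^ n) (1 / (1 - q) ^ a) := by
  have h := (Real.one_div_one_sub_rpow_hasFPowerSeriesOnBall_zero a).hasSum
    (y := q) (by simpa [enorm_eq_nnnorm, ← NNReal.coe_lt_one] using hq)
  simp only [zero_add, FormalMultilinearSeries.ofScalars_apply_eq] at h
  refine h.congr_fun fun n => ?_
  have h1 : (n.factorial : ℝ) ≠ 0 := by positivity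
  rw [poch_eq_factorial_mul_choose, mul_div_cancel_left₀ _ h1, smul_eq_mul]

lemma sum_antidiagonal_pow_div_factorial (X Y : ℝ) (n : ℕ) :
    ∑ p ∈ Finset.HasAntidiagonal.antidiagonal n, X ^ p.1 * Y ^ p.2 / (p.1.factorial * p.2.factorial) =
      (X + Y) ^ n / n.factorial := by
  rw [(Commute.all X Y).add_pow', Finset.sum_div]
  refine Finset.sum_congr rfl fun p hp => ?_
  obtain rfl := Finset.HasAntidiagonal.mem_antidiagonal.mp hp
  have h : (((p.1 + p.2).choose p.1 : ℕ) : ℝ) * p.1.factorial * p.2.factorial =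
      (p.1 + p.2).factorial := by
    rw [Nat.choose_symm_add]
    exact_mod_cast Nat.add_choose_mul_factorial_mul_factorial p.1 p.2
  have h1 : (p.1.factorial : ℝ) ≠ 0 := by positivity
  have h2 : (p.2.factorial : ℝ) ≠ 0 := by positivity
  have h3 : ((p.1 + p.2).factorial : ℝ) ≠ 0 := by positivity
  rw [nsmul_eq_mul, div_eq_div_iff (by positivity) h3, ← h]
  ring

lemma sum_antidiagonal_fst_mul_pow_div_factorial (X Y : ℝ) (n : ℕ) :
    ∑ p ∈ Finset.HasAntidiagonal.antidiagonal (n + 1),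
      p.1 * (X ^ p.1 * Y ^ p.2 / (p.1.factorial * p.2.factorial)) =
      X * ((X + Y) ^ n / n.factorial) := by
  rw [Finset.Nat.sum_antidiagonal_succ, ← sum_antidiagonal_pow_div_factorial, Finset.mul_sum]
  simp only [Nat.cast_zero, zero_mul, zero_add]
  refine Finset.sum_congr rfl fun p hp => ?_
  have h1 : (p.1.factorial : ℝ) ≠ 0 := by positivity
  have h2 : (p.2.factorial : ℝ) ≠ 0 := by positivity
  rw [Nat.factorial_succ]
  push_cast
  field_simp
  ring

lemma sum_antidiagonal_snd_mul_pow_div_factorial (X Y : ℝ) (n : ℕ) :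
    ∑ p ∈ Finset.HasAntidiagonal.antidiagonal (n + 1),
      p.2 * (X ^ p.1 * Y ^ p.2 / (p.1.factorial * p.2.factorial)) =
      Y * ((X + Y) ^ n / n.factorial) := by
  rw [add_comm X Y, ← sum_antidiagonal_fst_mul_pow_div_factorial, ← Finset.Nat.sum_antidiagonal_swap]
  refine Finset.sum_congr rfl fun p hp => ?_
  simp only [Prod.fst_swap, Prod.snd_swap]
  ring

/-- The terms of the expansion of a combination of `(1 - X - Y) ^ (-1 / 2)` and
`(1 - X - Y) ^ (-3 / 2)` in powers of `X` and `Y`. -/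
noncomputable def binomTerm (X Y : ℝ) (p : ℕ × ℕ) : ℝ :=
  poch (1 / 2) (p.1 + p.2) / (p.1.factorial * p.2.factorial) * (1 + 3 * (p.1 + 2 * p.2)) *
    (X ^ p.1 * Y ^ p.2)

lemma sum_antidiagonal_binomTerm_zero (X Y : ℝ) :
    ∑ p ∈ Finset.HasAntidiagonal.antidiagonal 0, binomTerm X Y p = 1 := by
  simp [binomTerm, poch_zero]

lemma poch_succ' (x : ℝ) (n : ℕ) : poch x (n + 1) = x * poch (x + 1) n := by
  rw [mul_poch_add_one, poch_succ]

lemma sum_antidiagonal_binomTerm_succ (X Y : ℝ) (n : ℕ) :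
    ∑ p ∈ Finset.HasAntidiagonal.antidiagonal (n + 1), binomTerm X Y p =
      poch (1 / 2) (n + 1) / (n + 1).factorial * (X + Y) ^ (n + 1) +
        3 * (X + 2 * Y) / 2 * (poch (3 / 2) n / n.factorial * (X + Y) ^ n) := by
  have h : ∀ p ∈ Finset.HasAntidiagonal.antidiagonal (n + 1), binomTerm X Y p = poch (1 / 2) (n + 1) *
      (X ^ p.1 * Y ^ p.2 / (p.1.factorial * p.2.factorial) +
        3 * (p.1 * (X ^ p.1 * Y ^ p.2 / (p.1.factorial * p.2.factorial))) +
        6 * (p.2 * (X ^ p.1 * Y ^ p.2 / (p.1.factorial * p.2.factorial)))) := by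
    intro p hp
    rw [binomTerm, Finset.HasAntidiagonal.mem_antidiagonal.mp hp]
    ring
  rw [Finset.sum_congr rfl h, ← Finset.mul_sum, Finset.sum_add_distrib, Finset.sum_add_distrib,
    ← Finset.mul_sum, ← Finset.mul_sum, sum_antidiagonal_pow_div_factorial,
    sum_antidiagonal_fst_mul_pow_div_factorial, sum_antidiagonal_snd_mul_pow_div_factorial]
  have : poch (1 / 2) (n + 1) = 1 / 2 * poch (3 / 2) n := by
    rw [poch_succ']; norm_num
  rw [mul_add, mul_add]
  nth_rewrite 2 3 [this]
  ring

lemma hasSum_sum_antidiagonal_binomTerm {X Y : ℝ} (h : |X + Y| < 1) :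
    HasSum (fun n => ∑ p ∈ Finset.HasAntidiagonal.antidiagonal n, binomTerm X Y p)
      (1 / (1 - (X + Y)) ^ (1 / 2 : ℝ) +
        3 * (X + 2 * Y) / 2 * (1 / (1 - (X + Y)) ^ (3 / 2 : ℝ))) := by
  have h1 := (hasSum_nat_add_iff' 1).mpr (hasSum_poch_div_factorial (1 / 2) h)
  have h2 := (hasSum_poch_div_factorial (3 / 2) h).mul_left (3 * (X + 2 * Y) / 2)
  rw [← hasSum_nat_add_iff' 1]
  simp only [sum_antidiagonal_binomTerm_succ, Finset.sum_range_one,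
    sum_antidiagonal_binomTerm_zero]
  convert h1.add h2 using 1
  simp [poch_zero]
  ring

lemma summable_binomTerm {X Y : ℝ} (h : |X| + |Y| < 1) : Summable (binomTerm X Y) := by
  have habs : ∀ p, |binomTerm X Y p| = binomTerm |X| |Y| p := by
    intro p
    have : 0 < poch (1 / 2) (p.1 + p.2) := poch_pos (by norm_num) _
    rw [binomTerm, binomTerm, abs_mul, abs_mul (X ^ _), abs_pow, abs_pow, abs_of_nonneg]
    positivity
  have hpos : ∀ p, 0 ≤ binomTerm |X| |Y| p := fun p => habs p ▸ abs_nonneg _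
  refine Summable.of_norm ?_
  simp only [Real.norm_eq_abs, habs]
  refine Finset.HasAntidiagonal.sigmaAntidiagonalEquivProd.summable_iff.mp
    ((summable_sigma_of_nonneg fun _ => hpos _).mpr ⟨fun _ => (hasSum_fintype _).summable, ?_⟩)
  refine (hasSum_sum_antidiagonal_binomTerm (X := |X|) (Y := |Y|) ?_).summable.congr fun n => ?_
  · rwa [abs_of_nonneg (by positivity)]
  · rw [tsum_fintype, ← Finset.sum_coe_sort]
    rfl

lemma hasSum_binomTerm {X Y : ℝ} (h : |X| + |Y| < 1) :
    HasSum (binomTerm X Y) (1 / (1 - (X + Y)) ^ (1 / 2 : ℝ) +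
        3 * (X + 2 * Y) / 2 * (1 / (1 - (X + Y)) ^ (3 / 2 : ℝ))) := by
  have h1 := (summable_binomTerm h).hasSum
  have h2 := (Finset.HasAntidiagonal.sigmaAntidiagonalEquivProd.hasSum_iff.mpr h1).sigma
    (g := fun n => ∑ p ∈ Finset.HasAntidiagonal.antidiagonal n, binomTerm X Y p) fun n => by
      rw [← Finset.sum_coe_sort]
      exact hasSum_fintype _
  rwa [h2.unique (hasSum_sum_antidiagonal_binomTerm ((abs_add_le X Y).trans_lt h))] at h1

lemma integral_sin_pow_two_mul {a b : ℝ} (ha : sin a * cos a = 0) (hb : sin b * cos b = 0) (p : ℕ) :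
    ∫ x in a..b, sin x ^ (2 * p) = (b - a) * (poch (1 / 2) p / p.factorial) := by
  induction p with
  | zero => simp [poch_zero]
  | succ p ih =>
    rw [mul_add, mul_one, integral_sin_pow, ih, poch_succ, Nat.factorial_succ, pow_succ (sin a),
      pow_succ (sin b), mul_assoc, mul_assoc, ha, hb]
    have h1 : (p.factorial : ℝ) ≠ 0 := by positivity
    have h2 : (p + 1 : ℝ) ≠ 0 := by positivity
    push_cast
    field_simp
    ring

lemma integral_sin_pow_odd_symm (p : ℕ) :
    ∫ x in (-(π / 2))..(π / 2), sin x ^ (2 * p + 1) = 0 := by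
  induction p with
  | zero => simp
  | succ p ih =>
    rw [show 2 * (p + 1) + 1 = 2 * p + 1 + 2 by ring, integral_sin_pow, ih]
    simp

lemma factorial_two_mul_eq_poch (p : ℕ) :
    ((2 * p).factorial : ℝ) = 4 ^ p * p.factorial * poch (1 / 2) p := by
  induction p with
  | zero => simp [poch_zero]
  | succ p ih =>
    rw [mul_add, mul_one, Nat.factorial_succ, Nat.factorial_succ, Nat.factorial_succ, poch_succ]
    push_cast
    rw [ih]
    ring

/-- The measure on the rectangle `(0, π / 2) × (-π / 2, π / 2)`. -/
noncomputable def rectMeasure : Measure (ℝ × ℝ) :=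
  (volume.restrict (Set.Ioo 0 (π / 2))).prod (volume.restrict (Set.Ioo (-(π / 2)) (π / 2)))

lemma binomTerm_mul_left (t X Y : ℝ) (p : ℕ × ℕ) :
    binomTerm (t * X) Y p = binomTerm X Y p * t ^ p.1 := by
  simp only [binomTerm, mul_pow]
  ring

lemma poch_one (n : ℕ) : poch 1 n = n.factorial := by
  induction n with
  | zero => simp [poch_zero]
  | succ n ih => rw [poch_succ, ih, Nat.factorial_succ]; push_cast; ring

lemma wzTerm_zero_left (n : ℕ) :
    wzTerm 0 n = (poch (1 / 2) n / n.factorial) ^ 3 * (-1 / 8) ^ n := by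
  have h1 : (n.factorial : ℝ) ≠ 0 := by positivity
  simp only [wzTerm, mul_zero, add_zero, poch_one]
  field_simp

lemma binomTerm_even_mul (p l : ℕ) :
    binomTerm (-1 / √2) (-1 / 8) (2 * p, l) * (poch (1 / 2) p / p.factorial) ^ 2 =
      saalTerm p l * ((-1 / 8) ^ (p + l) * (6 * (p + l : ℕ) + 1)) := by
  have h1 : (p.factorial : ℝ) ≠ 0 := by positivity
  have h2 : (l.factorial : ℝ) ≠ 0 := by positivity
  have h3 : poch (1 / 2) p ≠ 0 := (poch_pos (by norm_num) p).ne'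
  have h4 : (-1 / √2 : ℝ) ^ (2 * p) = (1 / 2) ^ p := by
    rw [pow_mul, div_pow, Real.sq_sqrt (by norm_num)]
    norm_num
  have h5 : (1 / 2 : ℝ) ^ p / 4 ^ p = (-1) ^ p * (-1 / 8) ^ p := by
    rw [← div_pow, ← mul_pow]
    norm_num
  have h6 : (1 / 2 : ℝ) ^ p = (-1) ^ p * (-1 / 8) ^ p * 4 ^ p := by
    rw [← h5]; field_simp
  simp only [binomTerm, saalTerm, factorial_two_mul_eq_poch, h4, h6, pow_add (-1 / 8 : ℝ)]
  generalize (-1 / 8 : ℝ) ^ p = A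
  generalize (-1 / 8 : ℝ) ^ l = B
  generalize (-1 : ℝ) ^ p = C
  push_cast
  field_simp
  ring

lemma abs_add_abs_lt_one : |(-1 / √2 : ℝ)| + |(-1 / 8 : ℝ)| < 1 := by
  have h : (1.4 : ℝ) < √2 := Real.lt_sqrt_of_sq_lt (by norm_num)
  have h1 : 1 / √2 < 1 / 1.4 := one_div_lt_one_div_of_lt (by norm_num) h
  have h2 : |(-1 / √2 : ℝ)| = 1 / √2 := by
    rw [abs_div, abs_of_nonneg (Real.sqrt_nonneg 2)]; simp
  rw [h2]
  norm_num at h1 ⊢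
  linarith

lemma hasSum_binomTerm_mul_pow {t : ℝ} (ht : |t| ≤ 1) :
    HasSum (fun p => binomTerm (-1 / √2) (-1 / 8) p * t ^ p.1)
      (4 * ((3 * √2 - 2 * t) / (9 + 4 * √2 * t) ^ (3 / 2 : ℝ))) := by
  have h0 : |t * (-1 / √2)| + |(-1 / 8 : ℝ)| < 1 := by
    refine lt_of_le_of_lt ?_ abs_add_abs_lt_one
    rw [abs_mul]
    gcongr
    exact mul_le_of_le_one_left (abs_nonneg _) ht
  have h := (hasSum_binomTerm h0).congr_fun fun p => (binomTerm_mul_left t _ _ p).symm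
  convert h using 1
  have h1 := (abs_add_le (t * (-1 / √2)) (-1 / 8)).trans_lt h0
  set D := 1 - (t * (-1 / √2) + -1 / 8) with hD
  have hD0 : 0 < D := by linarith [(abs_lt.mp h1).2]
  have hs : √2 * √2 = 2 := Real.mul_self_sqrt (by norm_num)
  have hs0 : 0 < √2 := by positivity
  have hinv : 1 / √2 = √2 / 2 := by field_simp; linarith
  have ht' : t * √2 = 2 * D - 9 / 4 := by
    have : t * (-1 / √2) = - (t * √2) / 2 := by rw [neg_div, hinv]; ring
    rw [hD, this]; ring
  have e1 : 9 + 4 * √2 * t = 8 * D := by linear_combination 4 * ht'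
  have e2 : ∀ x : ℝ, 0 < x → x ^ (3 / 2 : ℝ) = x * √x := fun x hx => by
    rw [show (3 / 2 : ℝ) = 1 + 1 / 2 by norm_num, Real.rpow_add hx, Real.rpow_one,
      Real.sqrt_eq_rpow]
  have e3 : √(8 * D) = 2 * √2 * √D := by
    rw [Real.sqrt_mul (by norm_num), show (8 : ℝ) = 2 ^ 2 * 2 by norm_num,
      Real.sqrt_mul (by norm_num), Real.sqrt_sq (by norm_num)]
  have hr : 0 < √D := by positivity
  have e4 : t * (-1 / √2) = 9 / 8 - D := by rw [hD]; ring
  have e5 : 3 * √2 - 2 * t = √2 * (21 / 4 - 2 * D) := by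
    linear_combination (-√2) * ht' + t * hs
  rw [e1, e2 _ (by positivity), e2 _ hD0, e3, e4, e5, ← Real.sqrt_eq_rpow]
  clear_value D
  field_simp
  ring

lemma integral_rectMeasure (C : ℝ) (j : ℕ) :
    ∫ z, C * (sin z.1 * sin z.2) ^ j ∂rectMeasure =
      C * ((∫ x in (0)..(π / 2), sin x ^ j) * ∫ x in (-(π / 2))..(π / 2), sin x ^ j) := by
  have hpi := Real.pi_pos
  simp only [mul_pow]
  rw [integral_const_mul, rectMeasure, integral_prod_mul (fun x => sin x ^ j) (fun x => sin x ^ j),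
    intervalIntegral.integral_of_le (by linarith), intervalIntegral.integral_of_le (by linarith),
    integral_Ioc_eq_integral_Ioo, integral_Ioc_eq_integral_Ioo]

instance : IsFiniteMeasure rectMeasure := by
  unfold rectMeasure
  infer_instance

lemma integrable_rectMeasure (C : ℝ) (j : ℕ) :
    Integrable (fun z : ℝ × ℝ => C * (sin z.1 * sin z.2) ^ j) rectMeasure := by
  refine Integrable.of_bound (C := |C|) (Continuous.aestronglyMeasurable (by fun_prop)) ?_
  refine Eventually.of_forall fun z => ?_
  rw [norm_mul, norm_pow, norm_mul]
  refine mul_le_of_le_one_right (abs_nonneg C) (pow_le_one₀ (by positivity) ?_)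
  exact mul_le_one₀ (abs_sin_le_one _) (abs_nonneg _) (abs_sin_le_one _)

lemma integral_norm_le_rectMeasure (C : ℝ) (j : ℕ) :
    ∫ z, ‖C * (sin z.1 * sin z.2) ^ j‖ ∂rectMeasure ≤ rectMeasure.real Set.univ * |C| := by
  rw [← smul_eq_mul, ← integral_const]
  refine integral_mono (integrable_rectMeasure C j).norm (integrable_const _) fun z => ?_
  beta_reduce
  rw [norm_mul, norm_pow, norm_mul]
  refine mul_le_of_le_one_right (abs_nonneg C) (pow_le_one₀ (by positivity) ?_)
  exact mul_le_one₀ (abs_sin_le_one _) (abs_nonneg _) (abs_sin_le_one _)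

lemma hasSum_integral_binomTerm :
    HasSum (fun p : ℕ × ℕ => binomTerm (-1 / √2) (-1 / 8) p *
        ((∫ x in (0)..(π / 2), sin x ^ p.1) * ∫ x in (-(π / 2))..(π / 2), sin x ^ p.1))
      (∫ z, 4 * ((3 * √2 - 2 * (sin z.1 * sin z.2)) /
        (9 + 4 * √2 * (sin z.1 * sin z.2)) ^ (3 / 2 : ℝ)) ∂rectMeasure) := by
  have h := hasSum_integral_of_summable_integral_norm (μ := rectMeasure)
    (F := fun (p : ℕ × ℕ) (z : ℝ × ℝ) =>
      binomTerm (-1 / √2) (-1 / 8) p * (sin z.1 * sin z.2) ^ p.1)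
    (fun p => integrable_rectMeasure _ _)
    (Summable.of_nonneg_of_le (fun p => integral_nonneg fun z => norm_nonneg _)
      (fun p => integral_norm_le_rectMeasure _ _)
      ((summable_binomTerm abs_add_abs_lt_one).abs.mul_left _))
  simp only [integral_rectMeasure] at h
  have hz : ∀ z : ℝ × ℝ, |sin z.1 * sin z.2| ≤ 1 := fun z => by
    rw [abs_mul]
    exact mul_le_one₀ (abs_sin_le_one _) (abs_nonneg _) (abs_sin_le_one _)
  simpa only [(hasSum_binomTerm_mul_pow (hz _)).tsum_eq] using h

lemma hasSum_saalTerm_mul :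
    HasSum (fun p : ℕ × ℕ =>
        π ^ 2 / 2 * (saalTerm p.1 p.2 * ((-1 / 8) ^ (p.1 + p.2) * (6 * (p.1 + p.2 : ℕ) + 1))))
      (∫ z, 4 * ((3 * √2 - 2 * (sin z.1 * sin z.2)) /
        (9 + 4 * √2 * (sin z.1 * sin z.2)) ^ (3 / 2 : ℝ)) ∂rectMeasure) := by
  have hinj : Function.Injective fun p : ℕ × ℕ => (2 * p.1, p.2) := by
    rintro ⟨a, b⟩ ⟨c, d⟩ h
    simp only [Prod.mk.injEq] at h ⊢
    omega
  refine ((hinj.hasSum_iff ?_).mpr hasSum_integral_binomTerm).congr_fun fun p => ?_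
  · rintro ⟨j, l⟩ hj
    obtain ⟨i, rfl | rfl⟩ := Nat.even_or_odd' j
    · exact absurd ⟨(i, l), rfl⟩ hj
    · simp only [integral_sin_pow_odd_symm, mul_zero]
  · simp only [Function.comp_apply]
    rw [integral_sin_pow_two_mul (by simp) (by simp), integral_sin_pow_two_mul (by simp) (by simp),
      ← binomTerm_even_mul]
    ring

lemma integral_rectMeasure_algebraic :
    ∫ z, 4 * ((3 * √2 - 2 * (sin z.1 * sin z.2)) /
        (9 + 4 * √2 * (sin z.1 * sin z.2)) ^ (3 / 2 : ℝ)) ∂rectMeasure = √2 * π := by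
  have h := (Finset.HasAntidiagonal.sigmaAntidiagonalEquivProd.hasSum_iff.mpr
    hasSum_saalTerm_mul).sigma
    (g := fun n => π ^ 2 / 2 * (wzTerm 0 n * (6 * n + 4 * 0 + 1))) fun n => by
      convert hasSum_fintype _ using 1
      rw [wzTerm_zero_left, ← sum_saalTerm,
        ← Finset.Nat.sum_antidiagonal_eq_sum_range_succ saalTerm, Finset.sum_mul, Finset.sum_mul,
        Finset.mul_sum, ← Finset.sum_coe_sort]
      refine Finset.sum_congr rfl fun p hp => ?_
      simp only [Function.comp_apply, Finset.HasAntidiagonal.sigmaAntidiagonalEquivProd_apply,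
        Finset.HasAntidiagonal.mem_antidiagonal.mp p.2]
      ring
  have h' := (summable_wz le_rfl).hasSum.mul_left (π ^ 2 / 2)
  rw [h.unique h']
  change π ^ 2 / 2 * wzSum 0 = _
  rw [wzSum_zero]
  field_simp

lemma setLIntegral_eq_of_subset_of_sdiff_eq_zero {α : Type*} [MeasurableSpace α] {μ : Measure α}
    {s t : Set α} (hs : MeasurableSet s) (ht : MeasurableSet t) (hst : s ⊆ t) {f : α → ENNReal}
    (hf : ∀ x ∈ t \ s, f x = 0) :
    ∫⁻ x in s, f x ∂μ = ∫⁻ x in t, f x ∂μ := by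
  rw [← lintegral_inter_add_sdiff f t hs, Set.inter_eq_right.mpr hst,
    setLIntegral_congr_fun (ht.diff hs) hf, lintegral_zero, add_zero]

lemma sq_mul_sin_sq_lt_one {c : ℝ} (hc1 : c < 1) (hc0 : 0 < c) (θ : ℝ) :
    c ^ 2 * sin θ ^ 2 < 1 := by
  have h1 := sin_sq_le_one θ
  have h2 : c ^ 2 < 1 := by nlinarith
  nlinarith [sq_nonneg (sin θ), sq_nonneg c]

lemma ofReal_K {c : ℝ} (hc0 : 0 < c) (hc1 : c < 1) :
    ENNReal.ofReal (K c) =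
      ∫⁻ θ in Set.Ioo 0 (π / 2), ENNReal.ofReal (1 / √(1 - c ^ 2 * sin θ ^ 2)) := by
  have hpos : ∀ θ, 0 < 1 - c ^ 2 * sin θ ^ 2 := fun θ =>
    sub_pos.mpr (sq_mul_sin_sq_lt_one hc1 hc0 θ)
  have hcont : Continuous fun θ => 1 / √(1 - c ^ 2 * sin θ ^ 2) :=
    continuous_const.div (by fun_prop) fun θ => (Real.sqrt_pos.mpr (hpos θ)).ne'
  refine ofReal_integral_eq_lintegral_ofReal ?_ (Eventually.of_forall fun θ => by positivity)
  exact (hcont.integrableOn_Icc (a := 0) (b := π / 2)).mono_set Set.Ioo_subset_Icc_self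

lemma image_arccos_mul_sin {c : ℝ} (hc0 : 0 < c) (hc1 : c < 1) :
    (fun θ => arccos (c * sin θ)) '' Set.Ioo 0 (π / 2) = Set.Ioo (arccos c) (π / 2) := by
  ext a
  constructor
  · rintro ⟨θ, ⟨h0, h1⟩, rfl⟩
    have hs : 0 < sin θ := sin_pos_of_pos_of_lt_pi h0 (by linarith [Real.pi_pos])
    have hs1 : sin θ < 1 := by
      rw [← Real.sin_pi_div_two]
      exact sin_lt_sin_of_lt_of_le_pi_div_two (by linarith [Real.pi_pos]) le_rfl h1
    refine ⟨arccos_lt_arccos (by nlinarith) (by nlinarith) hc1.le, ?_⟩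
    simp only [arccos_lt_pi_div_two]
    positivity
  · rintro ⟨h0, h1⟩
    have ha0 := (arccos_nonneg c).trans_lt h0
    have hca : 0 < cos a := cos_pos_of_mem_Ioo ⟨by linarith, h1⟩
    have hcc : cos a < c := by
      rw [← cos_arccos (by linarith : -1 ≤ c) hc1.le]
      exact cos_lt_cos_of_nonneg_of_le_pi (arccos_nonneg c) (by linarith [Real.pi_pos]) h0
    have h2 : cos a / c < 1 := (div_lt_one hc0).mpr hcc
    have h3 : 0 < cos a / c := by positivity
    refine ⟨arcsin (cos a / c), ⟨arcsin_pos.mpr h3, arcsin_lt_pi_div_two.mpr h2⟩, ?_⟩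
    beta_reduce
    rw [sin_arcsin (by linarith) h2.le, mul_div_cancel₀ _ hc0.ne',
      arccos_cos ha0.le (by linarith [Real.pi_pos])]

lemma lintegral_sin_sq_sub {c : ℝ} (hc0 : 0 < c) (hc1 : c < 1) :
    ∫⁻ a in Set.Ioo 0 (π / 2), ENNReal.ofReal (1 / √(sin a ^ 2 - (1 - c ^ 2))) =
      ∫⁻ θ in Set.Ioo 0 (π / 2), ENNReal.ofReal (1 / √(1 - c ^ 2 * sin θ ^ 2)) := by
  have hsub : Set.Ioo (arccos c) (π / 2) ⊆ Set.Ioo 0 (π / 2) :=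
    Set.Ioo_subset_Ioo_left (arccos_nonneg c)
  have hz : ∀ a ∈ Set.Ioo 0 (π / 2) \ Set.Ioo (arccos c) (π / 2),
      ENNReal.ofReal (1 / √(sin a ^ 2 - (1 - c ^ 2))) = 0 := by
    rintro a ⟨⟨h0, h1⟩, h2⟩
    have h3 : a ≤ arccos c := not_lt.mp fun h => h2 ⟨h, h1⟩
    have h4 : c ≤ cos a := by
      rw [← cos_arccos (by linarith : -1 ≤ c) hc1.le]
      exact cos_le_cos_of_nonneg_of_le_pi h0.le (arccos_le_pi c) h3
    rw [Real.sqrt_eq_zero_of_nonpos]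
    · simp
    · nlinarith [sin_sq_add_cos_sq a]
  rw [← setLIntegral_eq_of_subset_of_sdiff_eq_zero measurableSet_Ioo measurableSet_Ioo hsub hz,
    ← image_arccos_mul_sin hc0 hc1]
  have hpos : ∀ θ, 0 < 1 - c ^ 2 * sin θ ^ 2 := fun θ =>
    sub_pos.mpr (sq_mul_sin_sq_lt_one hc1 hc0 θ)
  have hlt : ∀ θ, |c * sin θ| < 1 := fun θ => by
    rw [← sq_lt_one_iff_abs_lt_one, mul_pow]
    exact sq_mul_sin_sq_lt_one hc1 hc0 θ
  have hder : ∀ θ ∈ Set.Ioo 0 (π / 2), HasDerivWithinAt (fun θ => arccos (c * sin θ))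
      (-(1 / √(1 - (c * sin θ) ^ 2)) * (c * cos θ)) (Set.Ioo 0 (π / 2)) θ := by
    intro θ _
    have h := abs_lt.mp (hlt θ)
    exact ((hasDerivAt_arccos h.1.ne' h.2.ne).comp θ
      ((hasDerivAt_sin θ).const_mul c)).hasDerivWithinAt
  have hinj : Set.InjOn (fun θ => arccos (c * sin θ)) (Set.Ioo 0 (π / 2)) := by
    intro x hx y hy h
    have h1 := abs_lt.mp (hlt x)
    have h2 := abs_lt.mp (hlt y)
    have h3 := arccos_injOn ⟨h1.1.le, h1.2.le⟩ ⟨h2.1.le, h2.2.le⟩ h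
    exact injOn_sin ⟨by linarith [hx.1, hx.2], hx.2.le⟩ ⟨by linarith [hy.1, hy.2], hy.2.le⟩
      (mul_left_cancel₀ hc0.ne' h3)
  rw [lintegral_image_eq_lintegral_abs_deriv_mul measurableSet_Ioo hder hinj]
  refine setLIntegral_congr_fun measurableSet_Ioo fun θ hθ => ?_
  have hcos : 0 < cos θ := cos_pos_of_mem_Ioo ⟨by linarith [hθ.1, hθ.2], hθ.2⟩
  have hs := Real.sqrt_pos.mpr (hpos θ)
  have e : sin (arccos (c * sin θ)) ^ 2 - (1 - c ^ 2) = (c * cos θ) ^ 2 := by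
    rw [sin_arccos, Real.sq_sqrt (by rw [mul_pow]; exact (hpos θ).le)]
    linear_combination (-c ^ 2) * sin_sq_add_cos_sq θ
  rw [← ENNReal.ofReal_mul (abs_nonneg _), e, Real.sqrt_sq (by positivity), mul_pow, neg_mul,
    abs_neg, abs_of_nonneg (by positivity)]
  congr 1
  field_simp

/-- The algebraic factor of the integrand. -/
noncomputable def algFactor (x : ℝ) : ℝ :=
  (4 * x + 3 * √2 - 2) / (4 * √2 + 9 - 8 * √2 * x) ^ (3 / 2 : ℝ)

lemma algFactor_eq (t : ℝ) :
    algFactor ((1 - t) / 2) = (3 * √2 - 2 * t) / (9 + 4 * √2 * t) ^ (3 / 2 : ℝ) := by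
  rw [algFactor]
  ring_nf

lemma algFactor_nonneg {x : ℝ} (hx0 : 0 ≤ x) (hx1 : x ≤ 1) : 0 ≤ algFactor x := by
  have h1 : 1.4 < √2 := Real.lt_sqrt_of_sq_lt (by norm_num)
  have h2 : √2 < 1.5 := (Real.sqrt_lt' (by norm_num)).mpr (by norm_num)
  norm_num at h1 h2
  refine div_nonneg (by linarith) (Real.rpow_nonneg ?_ _)
  nlinarith

lemma measurable_algFactor : Measurable algFactor := by
  unfold algFactor
  fun_prop

lemma image_one_sub_mul_sin {s : ℝ} (hs : 0 < s) :
    (fun b => (1 - s * sin b) / 2) '' Set.Ioo (-(π / 2)) (π / 2) =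
      Set.Ioo ((1 - s) / 2) ((1 + s) / 2) := by
  ext x
  constructor
  · rintro ⟨b, ⟨h0, h1⟩, rfl⟩
    have hc : 0 < cos b := cos_pos_of_mem_Ioo ⟨h0, h1⟩
    have h2 : -1 < sin b ∧ sin b < 1 := by
      constructor <;> nlinarith [sin_sq_add_cos_sq b]
    constructor <;> beta_reduce <;> nlinarith
  · rintro ⟨h0, h1⟩
    have h2 : (1 - 2 * x) / s < 1 := (div_lt_one hs).mpr (by linarith)
    have h3 : -1 < (1 - 2 * x) / s := by rw [lt_div_iff₀ hs]; linarith
    refine ⟨arcsin ((1 - 2 * x) / s), ⟨neg_pi_div_two_lt_arcsin.mpr h3,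
      arcsin_lt_pi_div_two.mpr h2⟩, ?_⟩
    beta_reduce
    rw [sin_arcsin h3.le h2.le, mul_div_cancel₀ _ hs.ne']
    ring

lemma lintegral_mul_algFactor {s : ℝ} (hs : 0 < s) (hs1 : s ≤ 1) :
    ∫⁻ x in Set.Ioo (0 : ℝ) 1,
        ENNReal.ofReal (1 / √(s ^ 2 - (1 - 2 * x) ^ 2)) * ENNReal.ofReal (algFactor x) =
      ∫⁻ b in Set.Ioo (-(π / 2)) (π / 2), ENNReal.ofReal (algFactor ((1 - s * sin b) / 2) / 2) := by
  have hsub : Set.Ioo ((1 - s) / 2) ((1 + s) / 2) ⊆ Set.Ioo 0 1 :=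
    Set.Ioo_subset_Ioo (by linarith) (by linarith)
  have hz : ∀ x ∈ Set.Ioo (0 : ℝ) 1 \ Set.Ioo ((1 - s) / 2) ((1 + s) / 2),
      ENNReal.ofReal (1 / √(s ^ 2 - (1 - 2 * x) ^ 2)) * ENNReal.ofReal (algFactor x) = 0 := by
    rintro x ⟨_, h⟩
    have h1 : s ^ 2 - (1 - 2 * x) ^ 2 ≤ 0 := by
      by_contra! h2
      have h3 := abs_lt.mp (sq_lt_sq₀ (abs_nonneg _) hs.le |>.mp
        (by rw [sq_abs]; linarith : |1 - 2 * x| ^ 2 < s ^ 2))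
      exact h ⟨by linarith, by linarith⟩
    rw [Real.sqrt_eq_zero_of_nonpos h1]
    simp
  rw [← setLIntegral_eq_of_subset_of_sdiff_eq_zero measurableSet_Ioo measurableSet_Ioo hsub hz,
    ← image_one_sub_mul_sin hs]
  have hder : ∀ b ∈ Set.Ioo (-(π / 2)) (π / 2), HasDerivWithinAt (fun b => (1 - s * sin b) / 2)
      (-(s * cos b) / 2) (Set.Ioo (-(π / 2)) (π / 2)) b := fun b _ =>
    ((((hasDerivAt_sin b).const_mul s).const_sub 1).div_const 2).hasDerivWithinAt
  have hinj : Set.InjOn (fun b => (1 - s * sin b) / 2) (Set.Ioo (-(π / 2)) (π / 2)) := by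
    intro x hx y hy h
    beta_reduce at h
    exact injOn_sin (Set.Ioo_subset_Icc_self hx) (Set.Ioo_subset_Icc_self hy)
      (mul_left_cancel₀ hs.ne' (by linarith))
  rw [lintegral_image_eq_lintegral_abs_deriv_mul measurableSet_Ioo hder hinj]
  refine setLIntegral_congr_fun measurableSet_Ioo fun b hb => ?_
  have hcos : 0 < cos b := cos_pos_of_mem_Ioo hb
  have e : s ^ 2 - (1 - 2 * ((1 - s * sin b) / 2)) ^ 2 = (s * cos b) ^ 2 := by
    linear_combination (-s ^ 2) * sin_sq_add_cos_sq b
  rw [e, Real.sqrt_sq (by positivity), ← mul_assoc, ← ENNReal.ofReal_mul (abs_nonneg _),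
    ← ENNReal.ofReal_mul (by positivity), neg_div, abs_neg, abs_of_nonneg (by positivity)]
  congr 1
  field_simp

lemma measurable_K : Measurable K := by
  have h : StronglyMeasurable (Function.uncurry fun k θ : ℝ => 1 / √(1 - k ^ 2 * sin θ ^ 2)) := by
    refine Measurable.stronglyMeasurable ?_
    unfold Function.uncurry
    fun_prop
  exact h.integral_prod_right.measurable

lemma K_nonneg (k : ℝ) : 0 ≤ K k := integral_nonneg fun θ => by positivity

lemma ofReal_K_two_mul_sqrt {x : ℝ} (hx : x ∈ Set.Ioo (0 : ℝ) 1) (hx' : x ≠ 1 / 2) :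
    ENNReal.ofReal (K (2 * √(x * (1 - x)))) =
      ∫⁻ a in Set.Ioo 0 (π / 2), ENNReal.ofReal (1 / √(sin a ^ 2 - (1 - 2 * x) ^ 2)) := by
  have h0 : 0 < x * (1 - x) := mul_pos hx.1 (by linarith [hx.2])
  have hc0 : 0 < 2 * √(x * (1 - x)) := by positivity
  have hsq : (2 * √(x * (1 - x))) ^ 2 = 4 * (x * (1 - x)) := by
    rw [mul_pow, Real.sq_sqrt h0.le]; norm_num
  have h1 : 0 < (1 - 2 * x) ^ 2 := by
    have : 1 - 2 * x ≠ 0 := fun h => hx' (by linarith)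
    positivity
  have hc1 : 2 * √(x * (1 - x)) < 1 := by
    rw [← sq_lt_one_iff₀ hc0.le, hsq]
    linarith
  rw [ofReal_K hc0 hc1, ← lintegral_sin_sq_sub hc0 hc1, hsq,
    show 1 - 4 * (x * (1 - x)) = (1 - 2 * x) ^ 2 by ring]

lemma lintegral_K_mul_algFactor :
    ∫⁻ x in Set.Ioo (0 : ℝ) 1, ENNReal.ofReal (K (2 * √(x * (1 - x))) * algFactor x) =
      ∫⁻ z, ENNReal.ofReal (algFactor ((1 - sin z.1 * sin z.2) / 2) / 2) ∂rectMeasure := by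
  have hm : Measurable fun z : ℝ × ℝ =>
      ENNReal.ofReal (algFactor ((1 - sin z.1 * sin z.2) / 2) / 2) :=
    ((measurable_algFactor.comp (by fun_prop)).div_const 2).ennreal_ofReal
  have hm' : Measurable (Function.uncurry fun x a : ℝ =>
      ENNReal.ofReal (1 / √(sin a ^ 2 - (1 - 2 * x) ^ 2)) * ENNReal.ofReal (algFactor x)) := by
    unfold Function.uncurry
    have := measurable_algFactor
    fun_prop
  rw [rectMeasure, lintegral_prod _ hm.aemeasurable]
  calc _ = ∫⁻ x in Set.Ioo (0 : ℝ) 1, ∫⁻ a in Set.Ioo 0 (π / 2),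
        ENNReal.ofReal (1 / √(sin a ^ 2 - (1 - 2 * x) ^ 2)) * ENNReal.ofReal (algFactor x) := by
        refine lintegral_congr_ae ?_
        filter_upwards [ae_restrict_mem measurableSet_Ioo,
          ae_restrict_of_ae (Measure.ae_ne volume (1 / 2 : ℝ))] with x hx hx'
        rw [ENNReal.ofReal_mul (K_nonneg _), ofReal_K_two_mul_sqrt hx hx',
          lintegral_mul_const]
        fun_prop
    _ = ∫⁻ a in Set.Ioo 0 (π / 2), ∫⁻ x in Set.Ioo (0 : ℝ) 1,
        ENNReal.ofReal (1 / √(sin a ^ 2 - (1 - 2 * x) ^ 2)) * ENNReal.ofReal (algFactor x) :=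
        lintegral_lintegral_swap hm'.aemeasurable
    _ = _ := by
        refine setLIntegral_congr_fun measurableSet_Ioo fun a ha => ?_
        exact lintegral_mul_algFactor
          (sin_pos_of_pos_of_lt_pi ha.1 (by linarith [ha.2, Real.pi_pos])) (sin_le_one a)

theorem stmt13 :
    ∫ x in (0:ℝ)..1, K (2 * Real.sqrt (x * (1 - x))) * (4 * x + 3 * Real.sqrt 2 - 2) /
        (4 * Real.sqrt 2 + 9 - 8 * Real.sqrt 2 * x) ^ ((3:ℝ)/2) =
      Real.pi / (4 * Real.sqrt 2) := by
  simp only [mul_div_assoc]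
  change ∫ x in (0:ℝ)..1, K (2 * √(x * (1 - x))) * algFactor x = _
  have hrange : ∀ z : ℝ × ℝ, 0 ≤ algFactor ((1 - sin z.1 * sin z.2) / 2) := fun z => by
    have h : |sin z.1 * sin z.2| ≤ 1 := by
      rw [abs_mul]
      exact mul_le_one₀ (abs_sin_le_one _) (abs_nonneg _) (abs_sin_le_one _)
    have := abs_le.mp h
    exact algFactor_nonneg (by linarith) (by linarith)
  have hm : Measurable fun z : ℝ × ℝ => algFactor ((1 - sin z.1 * sin z.2) / 2) / 2 :=
    (measurable_algFactor.comp (by fun_prop)).div_const 2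
  rw [intervalIntegral.integral_of_le zero_le_one, integral_Ioc_eq_integral_Ioo,
    integral_eq_lintegral_of_nonneg_ae, lintegral_K_mul_algFactor,
    ← integral_eq_lintegral_of_nonneg_ae (Eventually.of_forall fun z => by
      have := hrange z
      positivity) hm.aestronglyMeasurable]
  · have h := integral_rectMeasure_algebraic
    simp only [← algFactor_eq] at h
    rw [integral_const_mul] at h
    rw [integral_div]
    have hs : √2 * √2 = 2 := Real.mul_self_sqrt (by norm_num)
    rw [eq_div_iff (by positivity)]
    linear_combination √2 / 2 * h + π / 2 * hs
  · filter_upwards [ae_restrict_mem measurableSet_Ioo] with x hx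
    exact mul_nonneg (K_nonneg _) (algFactor_nonneg hx.1.le hx.2.le)
  · exact ((measurable_K.comp (by fun_prop)).mul measurable_algFactor).aestronglyMeasurable
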